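/- arXiv:2303.02526 — 3 statements merged into one kernel-verified Lean document; each statement's English description precedes it below -/
import Mathlib

section
/- Let n, r ∈ ℕ with 2 ≤ r ≤ ⌈n/2⌉. Then there exists a stable configuration K* reachable from the pulse K(n,r) by firing moves such that K* ≠ Az(n). -/
/-- Manhattan distance between faces of the grid. -/
def gdist (f g : ℤ × ℤ) : ℤ := |f.1 - g.1| + |f.2 - g.2|

/-- The marked face. -/
def f₀ : ℤ × ℤ := (0, 0)

/-- The Aztec diamond configuration `Az(n)`. -/
def Az (n : ℕ) : ℤ × ℤ → ℤ :=
  fun f => if f = f₀ then (n : ℤ) else max ((n : ℤ) - gdist f₀ f + 1) 0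

/-- The pulse `K(n,r)`: value `n` within Manhattan distance `r` of `f₀`, `0` elsewhere. -/
def pulse (n r : ℕ) : ℤ × ℤ → ℤ :=
  fun f => if gdist f₀ f ≤ (r : ℤ) then (n : ℤ) else 0

/-- A single firing move with marked face `f₀`. -/
def Fire (n : ℕ) (K K' : ℤ × ℤ → ℤ) : Prop :=
  (∃ f g : ℤ × ℤ, gdist f g = 1 ∧ f ≠ f₀ ∧ g ≠ f₀ ∧ K g + 2 ≤ K f ∧
      K' = Function.update (Function.update K f (K f - 1)) g (K g + 1)) ∨
  (∃ f : ℤ × ℤ, gdist f f₀ = 1 ∧ K f < (n : ℤ) ∧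
      K' = Function.update K f (K f + 1)) ∨
  (∃ f : ℤ × ℤ, gdist f f₀ = 1 ∧ (n : ℤ) < K f ∧
      K' = Function.update K f (K f - 1))

/-- `K'` is reachable from `K` by firing moves. -/
def Reaches (n : ℕ) (K K' : ℤ × ℤ → ℤ) : Prop :=
  Relation.ReflTransGen (Fire n) K K'

/-- A configuration is stable if no firing move applies. -/
def Stable (n : ℕ) (K : ℤ × ℤ → ℤ) : Prop := ∀ K', ¬ Fire n K K'

theorem gdist_comm (f g : ℤ × ℤ) : gdist f g = gdist g f := by
  simp only [gdist, abs_sub_comm]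

theorem gdist_f₀_le (f g : ℤ × ℤ) : gdist f₀ g ≤ gdist f₀ f + gdist f g := by
  have h₁ := abs_sub_le (0 : ℤ) f.1 g.1
  have h₂ := abs_sub_le (0 : ℤ) f.2 g.2
  simp only [gdist, f₀]
  linarith

theorem gdist_ne {f g : ℤ × ℤ} (h : gdist f g = 1) : f ≠ g := by
  rintro rfl
  simp [gdist] at h

/-- Values lie in `[0, n]`, and decay to `0` with slope one beyond distance `r`. -/
def Confined (n r : ℕ) (K : ℤ × ℤ → ℤ) : Prop :=
  ∀ f, 0 ≤ K f ∧ K f ≤ n ∧ (K f = 0 ∨ K f ≤ n + r - gdist f₀ f)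

theorem confined_pulse (n r : ℕ) : Confined n r (pulse n r) := by
  intro f
  unfold pulse
  split_ifs with h
  · refine ⟨by omega, le_rfl, Or.inr (by omega)⟩
  · refine ⟨le_rfl, by omega, Or.inl rfl⟩

theorem Confined.fire {n r : ℕ} (hr : 1 ≤ r) {K K' : ℤ × ℤ → ℤ} (hK : Confined n r K)
    (h : Fire n K K') : Confined n r K' := by
  intro x
  rcases h with ⟨f, g, hd, -, -, hfg, rfl⟩ | ⟨f, hd, hf, rfl⟩ | ⟨f, hd, hf, rfl⟩
  · have hd' := gdist_f₀_le f g
    have hx := hK x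
    have hf := hK f
    have hg := hK g
    by_cases hxg : x = g
    · subst hxg
      rw [Function.update_self]
      omega
    · rw [Function.update_of_ne hxg]
      by_cases hxf : x = f
      · subst hxf
        rw [Function.update_self]
        omega
      · rwa [Function.update_of_ne hxf]
  · have hx := hK x
    rw [gdist_comm] at hd
    by_cases hxf : x = f
    · subst hxf
      rw [Function.update_self]
      omega
    · rwa [Function.update_of_ne hxf]
  · have := hK f
    omega

theorem Confined.reaches {n r : ℕ} (hr : 1 ≤ r) {K K' : ℤ × ℤ → ℤ} (hK : Confined n r K)
    (h : Reaches n K K') : Confined n r K' := by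
  induction h with
  | refl => exact hK
  | tail _ h ih => exact ih.fire hr h

/-- An occupied face never becomes empty again. -/
theorem Confined.one_le_of_reaches {n r : ℕ} (hr : 1 ≤ r) {K K' : ℤ × ℤ → ℤ}
    (hK : Confined n r K) (h : Reaches n K K') {x : ℤ × ℤ} (hx : 1 ≤ K x) : 1 ≤ K' x := by
  induction h with
  | refl => exact hx
  | @tail L L' hKL h ih =>
    have hL := hK.reaches hr hKL
    rcases h with ⟨f, g, hd, -, -, hfg, rfl⟩ | ⟨f, hd, hf, rfl⟩ | ⟨f, hd, hf, rfl⟩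
    · have hg := hL g
      simp only [Function.update_apply]
      split_ifs with h₁ h₂
      · omega
      · omega
      · exact ih
    · simp only [Function.update_apply]
      split_ifs with h₁
      · subst h₁
        omega
      · exact ih
    · have := hL f
      omega

/-- A box containing the support of every confined configuration. -/
noncomputable def box (n r : ℕ) : Finset (ℤ × ℤ) :=
  Finset.Icc (-((n : ℤ) + r), -((n : ℤ) + r)) ((n : ℤ) + r, (n : ℤ) + r)

theorem mem_box {n r : ℕ} {f : ℤ × ℤ} (h : gdist f₀ f ≤ n + r) : f ∈ box n r := by
  simp only [gdist, f₀, zero_sub, abs_neg] at h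
  have h₁ := abs_nonneg f.1
  have h₂ := abs_nonneg f.2
  have h₃ := abs_le.1 (show |f.1| ≤ (n : ℤ) + r by linarith)
  have h₄ := abs_le.1 (show |f.2| ≤ (n : ℤ) + r by linarith)
  simp only [box, Finset.mem_Icc, Prod.le_def]
  exact ⟨⟨h₃.1, h₄.1⟩, h₃.2, h₄.2⟩

/-- The potential that decreases along firing moves. -/
noncomputable def energy (n r : ℕ) (K : ℤ × ℤ → ℤ) : ℤ := ∑ f ∈ box n r, (K f - n) ^ 2

theorem energy_nonneg (n r : ℕ) (K : ℤ × ℤ → ℤ) : 0 ≤ energy n r K :=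
  Finset.sum_nonneg fun _ _ => sq_nonneg _

theorem Confined.energy_lt {n r : ℕ} (hr : 1 ≤ r) {K K' : ℤ × ℤ → ℤ} (hK : Confined n r K)
    (h : Fire n K K') : energy n r K' < energy n r K := by
  have hbox : ∀ f, 1 ≤ K f → f ∈ box n r := fun f hf =>
    mem_box (by have := hK f; omega)
  rw [← sub_neg, energy, energy, ← Finset.sum_sub_distrib]
  rcases h with ⟨f, g, hd, -, -, hfg, rfl⟩ | ⟨f, hd, hf, rfl⟩ | ⟨f, hd, hf, rfl⟩
  · have hne := gdist_ne hd
    have hg := hK g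
    have hfm : f ∈ box n r := hbox f (by omega)
    have hgm : g ∈ box n r := by
      have hf := hK f
      have := gdist_f₀_le f g
      exact mem_box (by omega)
    rw [← Finset.sum_subset (s₁ := {f, g})]
    · rw [Finset.sum_pair hne, Function.update_self, Function.update_of_ne hne,
        Function.update_self]
      nlinarith
    · intro x hx
      simp only [Finset.mem_insert, Finset.mem_singleton] at hx
      rcases hx with rfl | rfl <;> assumption
    · intro x _ hx
      simp only [Finset.mem_insert, Finset.mem_singleton, not_or] at hx
      rw [Function.update_of_ne hx.2, Function.update_of_ne hx.1, sub_self]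
  · rw [gdist_comm] at hd
    rw [Finset.sum_eq_single_of_mem f (mem_box (by omega))]
    · rw [Function.update_self]
      nlinarith
    · intro x _ hx
      rw [Function.update_of_ne hx, sub_self]
  · have := hK f
    omega

/-- Firing while keeping the value on a set of frozen faces always terminates. -/
theorem Confined.exists_stable {n r : ℕ} (hr : 1 ≤ r) (A : Set (ℤ × ℤ)) {K : ℤ × ℤ → ℤ}
    (hK : Confined n r K) :
    ∃ K', Reaches n K K' ∧ (∀ f ∈ A, K' f = K f) ∧
      ∀ L, Fire n K' L → ∃ f ∈ A, L f ≠ K' f := by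
  induction hm : (energy n r K).toNat using Nat.strong_induction_on generalizing K with
  | _ m ih =>
    by_cases hs : ∀ L, Fire n K L → ∃ f ∈ A, L f ≠ K f
    · exact ⟨K, .refl, fun _ _ => rfl, hs⟩
    · push Not at hs
      obtain ⟨L, hL, hA⟩ := hs
      have hlt := hK.energy_lt hr hL
      have hnn := energy_nonneg n r L
      obtain ⟨K', h₁, h₂, h₃⟩ := ih _ (by omega) (hK.fire hr hL) rfl
      exact ⟨K', .head hL h₁, fun f hf => (h₂ f hf).trans (hA f hf), h₃⟩

theorem le_of_stable_off_corner {n : ℕ} {K : ℤ × ℤ → ℤ}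
    (hs : ∀ L, Fire n K L → ∃ f ∈ ({(1, 1)} : Set (ℤ × ℤ)), L f ≠ K f) (a : ℕ) :
    (n : ℤ) - (a + 2) ≤ K ((a : ℤ) + 2, 1) := by
  have hmove : ∀ f g : ℤ × ℤ, gdist f g = 1 → f ≠ f₀ → g ≠ f₀ → f ≠ (1, 1) → g ≠ (1, 1) →
      K f - 1 ≤ K g := by
    intro f g hd hf hg hf' hg'
    by_contra hlt
    obtain ⟨x, hx, hne⟩ := hs _ (Or.inl ⟨f, g, hd, hf, hg, by omega, rfl⟩)
    rw [Set.mem_singleton_iff] at hx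
    subst hx
    rw [Function.update_of_ne hg'.symm, Function.update_of_ne hf'.symm] at hne
    exact hne rfl
  have hone : (n : ℤ) ≤ K (1, 0) := by
    by_contra hlt
    obtain ⟨x, hx, hne⟩ := hs _ (Or.inr (Or.inl ⟨(1, 0), by simp [gdist, f₀], by omega, rfl⟩))
    rw [Set.mem_singleton_iff] at hx
    subst hx
    rw [Function.update_of_ne (by simp)] at hne
    exact hne rfl
  have haxis : ∀ b : ℕ, (n : ℤ) - b ≤ K ((b : ℤ) + 1, 0) := by
    intro b
    induction b with
    | zero => simpa using hone
    | succ b ih =>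
      have := hmove ((b : ℤ) + 1, 0) ((b : ℤ) + 1 + 1, 0) (by simp [gdist])
        (by simp [f₀]; omega) (by simp [f₀]; omega) (by simp) (by simp)
      push_cast
      linarith
  have h₁ := haxis (a + 1)
  have h₂ := hmove ((a : ℤ) + 2, 0) ((a : ℤ) + 2, 1) (by simp [gdist])
    (by simp [f₀]; omega) (by simp [f₀]) (by simp) (by simp; omega)
  push_cast at h₁
  rw [show (a : ℤ) + 1 + 1 = a + 2 by ring] at h₁
  linarith

/-- A surplus at `(1, 1)` can be carried along the row of height one. -/
theorem exists_reaches_surplus {n : ℕ} {K : ℤ × ℤ → ℤ} (hc : (n : ℤ) ≤ K (1, 1))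
    (hrow : ∀ a : ℕ, (n : ℤ) - (a + 2) ≤ K ((a : ℤ) + 2, 1)) (a : ℕ) :
    ∃ L, Reaches n K L ∧ (n : ℤ) - a ≤ L ((a : ℤ) + 1, 1) ∧
      ∀ b : ℕ, a ≤ b → (n : ℤ) - (b + 2) ≤ L ((b : ℤ) + 2, 1) := by
  induction a with
  | zero => exact ⟨K, .refl, by simpa using hc, fun b _ => hrow b⟩
  | succ a ih =>
    obtain ⟨L, hL, hsur, hb⟩ := ih
    have hcast : (((a + 1 : ℕ) : ℤ) + 1, (1 : ℤ)) = ((a : ℤ) + 2, 1) := by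
      push_cast
      ring_nf
    rw [hcast]
    push_cast
    by_cases hdone : (n : ℤ) - (a + 1) ≤ L ((a : ℤ) + 2, 1)
    · exact ⟨L, hL, hdone, fun b hab => hb b (by omega)⟩
    · have ha := hb a le_rfl
      refine ⟨_, hL.tail (Or.inl ⟨((a : ℤ) + 1, 1), ((a : ℤ) + 2, 1), ?_, ?_, ?_, ?_, rfl⟩),
        ?_, fun b hab => ?_⟩
      · simp only [gdist, sub_self, abs_zero, add_zero]
        rw [show (a : ℤ) + 1 - (a + 2) = -1 by ring]
        rfl
      · simp [f₀]
      · simp [f₀]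
      · omega
      · rw [Function.update_self]
        omega
      · rw [Function.update_of_ne (by simp; omega), Function.update_of_ne (by simp; omega)]
        exact hb b (by omega)

theorem second_regime_non_aztec_termination
    (n r : ℕ) (h2 : 2 ≤ r) (hr : r ≤ (n + 1) / 2) :
    ∃ Kstar : ℤ × ℤ → ℤ, Reaches n (pulse n r) Kstar ∧ Stable n Kstar ∧
      Kstar ≠ Az n := by
  have hr1 : 1 ≤ r := by omega
  have hP := confined_pulse n r
  obtain ⟨K, hPK, hfrozen, hs⟩ := hP.exists_stable hr1 {(1, 1)}
  have hK := hP.reaches hr1 hPK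
  have hcorner : (n : ℤ) ≤ K (1, 1) := by
    rw [hfrozen (1, 1) rfl, pulse, if_pos]
    simp only [gdist, f₀]
    norm_num
    exact_mod_cast h2
  obtain ⟨L, hKL, hsur, -⟩ :=
    exists_reaches_surplus hcorner (le_of_stable_off_corner hs) (n - 1)
  have hout : 1 ≤ L ((n : ℤ), 1) := by
    have hcast : ((n - 1 : ℕ) : ℤ) = n - 1 := by omega
    rw [hcast, sub_add_cancel] at hsur
    linarith
  have hL := hK.reaches hr1 hKL
  obtain ⟨M, hLM, -, hstab⟩ := hL.exists_stable hr1 ∅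
  refine ⟨M, (hPK.trans hKL).trans hLM, fun M' h => ?_, fun hM => ?_⟩
  · obtain ⟨f, hf, -⟩ := hstab M' h
    exact hf
  · have h₁ := hL.one_le_of_reaches hr1 hLM hout
    rw [hM, Az, if_neg (by simp [f₀])] at h₁
    simp [gdist, f₀] at h₁
end

section
/- Let n, r ∈ ℕ with 2 ≤ r ≤ ⌈n/2⌉. Then the Aztec diamond Az(n) is reachable from the pulse K(n,r) by firing moves; in particular, firing from K(n,r) can terminate in the stable configuration Az(n). -/
theorem gdist_f₀ (v : ℤ × ℤ) : gdist f₀ v = max v.1 (-v.1) + max v.2 (-v.2) := by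
  simp only [gdist, f₀, abs_eq_max_neg]
  omega

theorem gdist_comm_s5 (u v : ℤ × ℤ) : gdist u v = gdist v u := by
  simp only [gdist, abs_sub_comm]

theorem gdist_f₀_pos {v : ℤ × ℤ} : 1 ≤ gdist f₀ v ↔ v ≠ f₀ := by
  obtain ⟨a, b⟩ := v
  simp only [gdist_f₀]
  simp only [f₀, ne_eq, Prod.mk.injEq]
  omega

theorem gdist_f₀_self : gdist f₀ f₀ = 0 := by simp [gdist]

/-- The faces at Manhattan distance at most `m` from the marked face. -/
noncomputable def ballFinset (m : ℕ) : Finset (ℤ × ℤ) :=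
  (Finset.Icc (-(m : ℤ)) m ×ˢ Finset.Icc (-(m : ℤ)) m).filter fun v => gdist f₀ v ≤ m

theorem mem_ballFinset {m : ℕ} {v : ℤ × ℤ} : v ∈ ballFinset m ↔ gdist f₀ v ≤ m := by
  obtain ⟨a, b⟩ := v
  simp only [ballFinset, gdist_f₀, Finset.mem_filter, Finset.mem_product, Finset.mem_Icc]
  omega

/-- The face `i` steps outward from `v`, moving horizontally unless `v` is on the vertical axis. -/
def ray (v : ℤ × ℤ) (i : ℤ) : ℤ × ℤ :=
  if 0 < v.1 then (v.1 + i, v.2) else if v.1 < 0 then (v.1 - i, v.2)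
  else if 0 < v.2 then (v.1, v.2 + i) else (v.1, v.2 - i)

theorem ray_zero (v : ℤ × ℤ) : ray v 0 = v := by
  simp [ray]

theorem gdist_ray (v : ℤ × ℤ) {i : ℤ} (hi : 0 ≤ i) :
    gdist f₀ (ray v i) = gdist f₀ v + i := by
  obtain ⟨a, b⟩ := v
  simp only [gdist_f₀, ray]
  split_ifs <;> simp only <;> omega

theorem gdist_ray_succ (v : ℤ × ℤ) (i : ℤ) : gdist (ray v i) (ray v (i + 1)) = 1 := by
  obtain ⟨a, b⟩ := v
  simp only [gdist, ray, abs_eq_max_neg]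
  split_ifs <;> simp only <;> omega

theorem ray_ray {v : ℤ × ℤ} (hv : v ≠ f₀) {i : ℤ} (hi : 0 ≤ i) (j : ℤ) :
    ray (ray v i) j = ray v (i + j) := by
  obtain ⟨a, b⟩ := v
  simp only [f₀, ne_eq, Prod.mk.injEq] at hv
  simp only [ray]
  split_ifs <;> simp only [Prod.mk.injEq, and_true, true_and] at * <;> omega

theorem ray_left_injective {u v : ℤ × ℤ} (hu : u ≠ f₀) (hv : v ≠ f₀) {i : ℤ} (hi : 0 ≤ i)
    (h : ray u i = ray v i) : u = v := by
  obtain ⟨a, b⟩ := u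
  obtain ⟨c, d⟩ := v
  simp only [f₀, ne_eq, Prod.mk.injEq] at hu hv
  simp only [ray] at h
  split_ifs at h <;> simp only [Prod.mk.injEq] at * <;> omega

theorem exists_inner_neighbor {v : ℤ × ℤ} (hv : v ≠ f₀) :
    ∃ u, gdist u v = 1 ∧ gdist f₀ u = gdist f₀ v - 1 := by
  obtain ⟨a, b⟩ := v
  simp only [f₀, ne_eq, Prod.mk.injEq] at hv
  refine ⟨if 0 < a then (a - 1, b) else if a < 0 then (a + 1, b)
    else if 0 < b then (a, b - 1) else (a, b + 1), ?_⟩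
  simp only [gdist_f₀]
  simp only [gdist, abs_eq_max_neg]
  split_ifs <;> simp only <;> omega

/-- A unit can be carried from one end of a strictly decreasing path to the other end when the
last drop is at least `2`. -/
theorem reaches_transfer (n : ℕ) (w : ℕ → ℤ × ℤ) (m : ℕ) (hm : 1 ≤ m)
    (hw : ∀ i, gdist f₀ (w i) = gdist f₀ (w 0) + i) (h0 : w 0 ≠ f₀)
    (hadj : ∀ i, gdist (w i) (w (i + 1)) = 1) (K : ℤ × ℤ → ℤ)
    (hdec : ∀ i, i < m → K (w (i + 1)) + 1 ≤ K (w i))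
    (hlast : K (w m) + 2 ≤ K (w (m - 1))) :
    Reaches n K (Function.update (Function.update K (w 0) (K (w 0) - 1)) (w m) (K (w m) + 1)) := by
  have hne : ∀ i, w i ≠ f₀ := fun i => by
    have := gdist_f₀_pos.2 h0
    have := hw i
    exact gdist_f₀_pos.1 (by omega)
  have hinj : ∀ i j, w i = w j → i = j := fun i j h => by
    have := hw i
    have := hw j
    rw [h] at *
    omega
  induction m, hm using Nat.le_induction generalizing K with
  | base =>
    exact Relation.ReflTransGen.single
      (Or.inl ⟨w 0, w 1, hadj 0, hne _, hne _, by simpa using hlast, rfl⟩)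
  | succ m hm ih =>
    simp only [Nat.add_sub_cancel] at hlast
    have hmm : w m ≠ w (m + 1) := fun h => by have := hinj _ _ h; omega
    have h0m : w 0 ≠ w m := fun h => by have := hinj _ _ h; omega
    have h0s : w 0 ≠ w (m + 1) := fun h => by have := hinj _ _ h; omega
    set K₁ := Function.update (Function.update K (w m) (K (w m) - 1)) (w (m + 1))
      (K (w (m + 1)) + 1) with hK₁
    have hfire : Fire n K K₁ :=
      Or.inl ⟨w m, w (m + 1), hadj m, hne _, hne _, hlast, rfl⟩
    have hlt : ∀ i, i < m → K₁ (w i) = K (w i) := fun i hi => by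
      have h1 : w i ≠ w m := fun h => by have := hinj _ _ h; omega
      have h2 : w i ≠ w (m + 1) := fun h => by have := hinj _ _ h; omega
      simp [hK₁, h1, h2]
    have heq : K₁ (w m) = K (w m) - 1 := by simp [hK₁, hmm]
    refine Relation.ReflTransGen.head hfire (?_ : Reaches n K₁ _)
    convert ih K₁ ?_ ?_ using 1
    · funext v
      simp only [heq, hlt 0 (by omega)]
      simp only [hK₁, Function.update_apply]
      split_ifs <;> simp_all
    · intro i hi
      rw [hlt i hi]
      have := hdec i (by omega)
      rcases Nat.lt_or_ge (i + 1) m with h | h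
      · rw [hlt _ h]; exact this
      · obtain rfl : i + 1 = m := by omega
        rw [heq]; omega
    · rw [heq, hlt (m - 1) (by omega)]
      have := hdec (m - 1) (by omega)
      rw [Nat.sub_add_cancel hm] at this
      omega

theorem Az_of_ne {n : ℕ} {v : ℤ × ℤ} (hv : v ≠ f₀) :
    Az n v = max ((n : ℤ) - gdist f₀ v + 1) 0 := by
  simp [Az, hv]

/-- If a configuration agrees with the Aztec diamond closer to the marked face than `v`, a unit
can be brought from the marked face to a deficient face `v`. -/
theorem reaches_update_add_one (n d : ℕ) (K : ℤ × ℤ → ℤ) (v : ℤ × ℤ) (hv : v ≠ f₀)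
    (hd : gdist f₀ v = d) (hdn : d ≤ n) (hlt : K v < Az n v)
    (hin : ∀ u, gdist f₀ u < d → K u = Az n u) :
    Reaches n K (Function.update K v (K v + 1)) := by
  induction d generalizing K v with
  | zero =>
    have := gdist_f₀_pos.2 hv
    omega
  | succ d ih =>
    rw [Az_of_ne hv] at hlt
    rcases Nat.eq_zero_or_pos d with rfl | hpos
    · refine Relation.ReflTransGen.single (Or.inr (Or.inl ⟨v, ?_, ?_, rfl⟩))
      · rw [gdist_comm_s5]; simpa using hd
      · push_cast at hd; omega
    · obtain ⟨u, huv, hu⟩ := exists_inner_neighbor hv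
      push_cast at hd
      have hu0 : u ≠ f₀ := gdist_f₀_pos.1 (by omega)
      have hKu := hin u (by push_cast; omega)
      have hAu := Az_of_ne (n := n) hu0
      have hne : u ≠ v := by rintro rfl; omega
      set K₁ := Function.update (Function.update K u (K u - 1)) v (K v + 1) with hK₁
      have hfire : Fire n K K₁ :=
        Or.inl ⟨u, v, huv, hu0, hv, by omega, rfl⟩
      refine Relation.ReflTransGen.head hfire (?_ : Reaches n K₁ _)
      convert ih K₁ u hu0 (by omega) (by omega) ?_ ?_ using 1
      · funext x
        simp only [hK₁, Function.update_apply]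
        split_ifs <;> simp_all
      · simp [hK₁, hne, hKu]
      · intro x hx
        have h1 : x ≠ u := by rintro rfl; omega
        have h2 : x ≠ v := by rintro rfl; omega
        simp only [hK₁, Function.update_apply, h1, h2, if_false]
        exact hin x (by push_cast; omega)

theorem reaches_Az_of_le (n : ℕ) (K : ℤ × ℤ → ℤ) (h0 : K f₀ = n) (hnn : ∀ v, 0 ≤ K v)
    (hle : ∀ v, v ≠ f₀ → K v ≤ Az n v) : Reaches n K (Az n) := by
  obtain ⟨N, hN⟩ : ∃ N : ℕ, ∑ v ∈ ballFinset n, (Az n v - K v) ≤ N :=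
    ⟨_, Int.self_le_toNat _⟩
  have hA0 : Az n f₀ = n := by simp [Az]
  have hle' : ∀ v, K v ≤ Az n v := fun v => by
    by_cases hv : v = f₀
    · rw [hv, h0, hA0]
    · exact hle v hv
  induction N generalizing K with
  | zero =>
    have hsum : ∑ v ∈ ballFinset n, (Az n v - K v) = 0 :=
      le_antisymm (by simpa using hN) (Finset.sum_nonneg fun v _ => by linarith [hle' v])
    rw [Finset.sum_eq_zero_iff_of_nonneg fun v _ => by linarith [hle' v]] at hsum
    have : K = Az n := by
      funext v
      by_cases hv : v ∈ ballFinset n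
      · linarith [hsum v hv]
      · rw [mem_ballFinset] at hv
        have h1 : v ≠ f₀ := gdist_f₀_pos.1 (by omega)
        have := hle v h1
        have := hnn v
        rw [Az_of_ne h1] at *
        omega
    rw [this]
    exact Relation.ReflTransGen.refl
  | succ N ih =>
    by_cases hex : ∃ v, K v < Az n v
    · obtain ⟨v₀, hv₀⟩ := hex
      obtain ⟨v, hv, hmin⟩ := WellFounded.has_min
        (measure fun v : ℤ × ℤ => (gdist f₀ v).toNat).wf {v | K v < Az n v} ⟨v₀, hv₀⟩
      simp only [Set.mem_ofPred_eq] at hv hmin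
      have hv0 : v ≠ f₀ := by rintro rfl; omega
      have hpos := gdist_f₀_pos.2 hv0
      have hvn := hnn v
      have hAv := Az_of_ne (n := n) hv0
      have hstep := reaches_update_add_one n (gdist f₀ v).toNat K v hv0 (by omega) (by omega) hv
        fun u hu => by
          refine le_antisymm (hle' u) (not_lt.1 fun h => hmin u h ?_)
          change (gdist f₀ u).toNat < (gdist f₀ v).toNat
          omega
      have hupd : ∀ x, Function.update K v (K v + 1) x ≤ Az n x ∧
          K x ≤ Function.update K v (K v + 1) x := fun x => by
        have := hle' x
        by_cases hx : x = v
        · subst hx; simp only [Function.update_self]; omega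
        · simp only [Function.update_of_ne hx]; omega
      refine Relation.ReflTransGen.trans hstep (ih _ ?_ ?_ ?_ ?_ ?_)
      · rw [Function.update_of_ne hv0.symm, h0]
      · exact fun x => (hnn x).trans (hupd x).2
      · exact fun x _ => (hupd x).1
      · have : ∑ x ∈ ballFinset n, (Az n x - Function.update K v (K v + 1) x) <
            ∑ x ∈ ballFinset n, (Az n x - K x) := by
          refine Finset.sum_lt_sum (fun x _ => by linarith [(hupd x).2])
            ⟨v, mem_ballFinset.2 (by omega), ?_⟩
          simp
        push_cast at hN
        omega
      · exact fun x => (hupd x).1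
    · push Not at hex
      have : K = Az n := funext fun v => le_antisymm (hle' v) (hex v)
      rw [this]
      exact Relation.ReflTransGen.refl

/-- The radial profile obtained from the pulse by carrying the excess at each distance `d ≤ r`
to distance `2 r + 1 - d`. -/
def profile (n r : ℕ) (d : ℤ) : ℤ := if d ≤ r then (n : ℤ) - d + 1 else max (2 * (r : ℤ) - d) 0

/-- The reflection of `v` along its ray, exchanging distances `d` and `2 r + 1 - d`. -/
def reflect (r : ℕ) (v : ℤ × ℤ) : ℤ × ℤ := ray v (2 * ((r : ℤ) - gdist f₀ v) + 1)

theorem gdist_reflect {r : ℕ} {v : ℤ × ℤ} (hv : gdist f₀ v ≤ r) :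
    gdist f₀ (reflect r v) = 2 * r + 1 - gdist f₀ v := by
  rw [reflect, gdist_ray _ (by omega)]
  ring

theorem reflect_inj {r : ℕ} {u v : ℤ × ℤ} (hu0 : u ≠ f₀) (hv0 : v ≠ f₀)
    (hu : gdist f₀ u ≤ r) (hv : gdist f₀ v ≤ r) (h : reflect r u = reflect r v) : u = v := by
  have h1 := gdist_reflect hu
  have h2 := gdist_reflect hv
  rw [h] at h1
  have h3 : gdist f₀ u = gdist f₀ v := by omega
  rw [reflect, reflect, h3] at h
  exact ray_left_injective hu0 hv0 (by omega) h

/-- The excess over the profile inside the ball of radius `r` equals the deficit at the reflected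
faces, and there is no excess outside this ball. -/
structure BalancedAbout (n r : ℕ) (K : ℤ × ℤ → ℤ) : Prop where
  marked : K f₀ = n
  nonneg : ∀ v, 0 ≤ K v
  inner : ∀ v, v ≠ f₀ → gdist f₀ v ≤ r → profile n r (gdist f₀ v) ≤ K v
  outer : ∀ v, (r : ℤ) < gdist f₀ v → K v ≤ profile n r (gdist f₀ v)
  balance : ∀ v, v ≠ f₀ → gdist f₀ v ≤ r →
    K v + K (reflect r v) = profile n r (gdist f₀ v) + profile n r (gdist f₀ (reflect r v))

theorem balanced_pulse (n r : ℕ) : BalancedAbout n r (pulse n r) where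
  marked := by simp [pulse, gdist_f₀_self]
  nonneg v := by simp only [pulse]; split_ifs <;> omega
  inner v hv h := by
    have := gdist_f₀_pos.2 hv
    simp only [pulse, profile, h, if_true]
    omega
  outer v h := by
    simp only [pulse, profile]
    split_ifs <;> omega
  balance v hv h := by
    have := gdist_f₀_pos.2 hv
    simp only [pulse, profile, gdist_reflect h]
    split_ifs <;> omega

theorem BalancedAbout.exists_transfer {n r : ℕ} (hr : 2 * r ≤ n + 1) {K : ℤ × ℤ → ℤ}
    (hK : BalancedAbout n r K) {p : ℤ × ℤ} (hp0 : p ≠ f₀) (hpr : gdist f₀ p ≤ r)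
    (hp : profile n r (gdist f₀ p) < K p)
    (hmax : ∀ v, gdist f₀ p < gdist f₀ v → gdist f₀ v ≤ r → K v = profile n r (gdist f₀ v)) :
    Reaches n K (Function.update (Function.update K p (K p - 1)) (reflect r p)
      (K (reflect r p) + 1)) := by
  have hpos := gdist_f₀_pos.2 hp0
  obtain ⟨m, hm⟩ : ∃ m : ℕ, (m : ℤ) = 2 * ((r : ℤ) - gdist f₀ p) + 1 :=
    ⟨(2 * ((r : ℤ) - gdist f₀ p) + 1).toNat, by omega⟩
  have hd : ∀ i : ℕ, gdist f₀ (ray p i) = gdist f₀ p + i := fun i => gdist_ray p (by omega)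
  have hmid : ∀ i : ℕ, 0 < i → i < m →
      K (ray p i) = profile n r (gdist f₀ p + i) := by
    intro i hi him
    by_cases hir : gdist f₀ p + i ≤ r
    · rw [hmax _ (by rw [hd]; omega) (by rw [hd]; omega), hd]
    · have hj := hd (m - i)
      have hji : ((m - i : ℕ) : ℤ) = m - i := by omega
      have hrefl : reflect r (ray p ((m - i : ℕ) : ℤ)) = ray p i := by
        rw [reflect, ray_ray hp0 (by omega), hj]
        congr 1
        omega
      have hb := hK.balance (ray p ((m - i : ℕ) : ℤ)) (gdist_f₀_pos.1 (by omega)) (by omega)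
      have hc := hmax (ray p ((m - i : ℕ) : ℤ)) (by omega) (by omega)
      rw [hrefl, hd i] at hb
      omega
  have hfst : profile n r (gdist f₀ p + (0 : ℕ)) + 1 ≤ K (ray p (0 : ℕ)) := by
    simp only [Nat.cast_zero, ray_zero, add_zero]
    omega
  have hlst : K (ray p m) + 1 ≤ profile n r (gdist f₀ p + m) := by
    have hb := hK.balance p hp0 hpr
    have : reflect r p = ray p m := by rw [reflect, hm]
    rw [this, hd] at hb
    omega
  have hprof : ∀ i : ℕ, i < m →
      profile n r (gdist f₀ p + (i + 1 : ℕ)) + 1 ≤ profile n r (gdist f₀ p + i) := by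
    intro i hi
    simp only [profile]
    split_ifs <;> omega
  have hlow : ∀ i : ℕ, i < m → profile n r (gdist f₀ p + i) ≤ K (ray p i) := fun i hi => by
    rcases Nat.eq_zero_or_pos i with rfl | h
    · omega
    · rw [hmid i h hi]
  have hupp : ∀ i : ℕ, 0 < i → i ≤ m → K (ray p i) ≤ profile n r (gdist f₀ p + i) :=
    fun i hi him => by
      rcases him.eq_or_lt with rfl | h
      · omega
      · rw [hmid i hi h]
  have key := reaches_transfer n (fun i : ℕ => ray p i) m (by omega)
    (fun i => by simp only [hd]; simp) (by simpa [ray_zero] using hp0)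
    (fun i => by simpa using gdist_ray_succ p i) K
    (fun i hi => by
      have := hupp (i + 1) (by omega) (by omega)
      have := hprof i hi
      have := hlow i hi
      omega)
    (by
      have := hprof (m - 1) (by omega)
      have := hlow (m - 1) (by omega)
      rw [Nat.sub_add_cancel (by omega)] at *
      omega)
  simpa [ray_zero, reflect, hm] using key

theorem BalancedAbout.transfer {n r : ℕ} (hr : 2 * r ≤ n + 1) {K : ℤ × ℤ → ℤ}
    (hK : BalancedAbout n r K) {p : ℤ × ℤ} (hp0 : p ≠ f₀) (hpr : gdist f₀ p ≤ r)
    (hp : profile n r (gdist f₀ p) < K p) :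
    BalancedAbout n r (Function.update (Function.update K p (K p - 1)) (reflect r p)
      (K (reflect r p) + 1)) := by
  have hq := gdist_reflect hpr
  have hpos := gdist_f₀_pos.2 hp0
  have hne : p ≠ reflect r p := fun h => by rw [← h] at hq; omega
  have hq0 : reflect r p ≠ f₀ := gdist_f₀_pos.1 (by omega)
  have hb := hK.balance p hp0 hpr
  constructor
  · rw [Function.update_of_ne hq0.symm, Function.update_of_ne hp0.symm, hK.marked]
  · intro v
    have h1 := hK.nonneg v
    have h2 := hK.nonneg (reflect r p)
    have h3 : 0 ≤ profile n r (gdist f₀ p) := by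
      simp only [profile]; split_ifs <;> omega
    simp only [Function.update_apply]
    split_ifs <;> omega
  · intro v hv hvr
    have h1 := hK.inner v hv hvr
    have h2 : v ≠ reflect r p := by rintro rfl; omega
    rw [Function.update_of_ne h2, Function.update_apply]
    split_ifs with h
    · subst h; omega
    · exact h1
  · intro v hvr
    have h1 := hK.outer v hvr
    have h2 : v ≠ p := by rintro rfl; omega
    rw [Function.update_apply, Function.update_of_ne h2]
    split_ifs with h
    · subst h; omega
    · exact h1
  · intro v hv hvr
    have h1 := hK.balance v hv hvr
    have h2 : v ≠ reflect r p := by rintro rfl; omega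
    have h3 : reflect r v ≠ p := fun h => by
      have := gdist_reflect hvr
      rw [h] at this
      omega
    by_cases h : v = p
    · subst h
      rw [Function.update_of_ne h2]
      simp only [Function.update_self]
      omega
    · have h4 : reflect r v ≠ reflect r p := fun h' => h (reflect_inj hv hp0 hvr hpr h')
      rw [Function.update_of_ne h2, Function.update_of_ne h, Function.update_of_ne h4,
        Function.update_of_ne h3]
      exact h1

theorem BalancedAbout.reaches_Az {n r : ℕ} (hr : 2 * r ≤ n + 1) {K : ℤ × ℤ → ℤ}
    (hK : BalancedAbout n r K) : Reaches n K (Az n) := by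
  obtain ⟨N, hN⟩ : ∃ N : ℕ, ∑ v ∈ ballFinset r, K v ≤ N := ⟨_, Int.self_le_toNat _⟩
  induction N using Nat.strong_induction_on generalizing K with
  | _ N ih =>
    by_cases hex : ((ballFinset r).filter fun v =>
        v ≠ f₀ ∧ profile n r (gdist f₀ v) < K v).Nonempty
    · obtain ⟨p, hp, hmax⟩ := Finset.exists_max_image _ (gdist f₀) hex
      simp only [Finset.mem_filter, mem_ballFinset] at hp hmax
      obtain ⟨hpr, hp0, hlt⟩ := hp
      have hpos := gdist_f₀_pos.2 hp0
      have hq := gdist_reflect hpr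
      have hstep := hK.exists_transfer hr hp0 hpr hlt fun v h1 h2 => by
        have hv0 : v ≠ f₀ := gdist_f₀_pos.1 (by omega)
        refine le_antisymm (not_lt.1 fun h => ?_) (hK.inner v hv0 h2)
        have := hmax v ⟨h2, hv0, h⟩
        omega
      have hbal := hK.transfer hr hp0 hpr hlt
      set K' := Function.update (Function.update K p (K p - 1)) (reflect r p)
        (K (reflect r p) + 1) with hK'
      have hsum : ∑ v ∈ ballFinset r, K' v < ∑ v ∈ ballFinset r, K v := by
        have hval : ∀ v ∈ ballFinset r, K' v = if v = p then K p - 1 else K v := by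
          intro v hv
          rw [mem_ballFinset] at hv
          have h2 : v ≠ reflect r p := by rintro rfl; omega
          rw [hK', Function.update_of_ne h2, Function.update_apply]
        refine Finset.sum_lt_sum (fun v hv => ?_) ⟨p, mem_ballFinset.2 hpr, ?_⟩
        · rw [hval v hv]
          split_ifs with h
          · subst h; omega
          · exact le_rfl
        · rw [hval p (mem_ballFinset.2 hpr)]
          simp
      have hnn : 0 ≤ ∑ v ∈ ballFinset r, K' v := Finset.sum_nonneg fun v _ => hbal.nonneg v
      exact Relation.ReflTransGen.trans hstep
        (ih (∑ v ∈ ballFinset r, K' v).toNat (by omega) hbal (by omega))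
    · simp only [Finset.not_nonempty_iff_eq_empty, Finset.filter_eq_empty_iff, mem_ballFinset,
        not_and, not_lt] at hex
      refine reaches_Az_of_le n K hK.marked hK.nonneg fun v hv => ?_
      have hpos := gdist_f₀_pos.2 hv
      rw [Az_of_ne hv]
      by_cases hvr : gdist f₀ v ≤ r
      · have := hex hvr hv
        simp only [profile, hvr, if_true] at this
        omega
      · have := hK.outer v (by omega)
        simp only [profile, hvr, if_false] at this
        omega

theorem stable_Az (n : ℕ) : Stable n (Az n) := by
  have hnb : ∀ f, gdist f f₀ = 1 → Az n f = n := fun f hf => by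
    rw [gdist_comm_s5] at hf
    rw [Az_of_ne (gdist_f₀_pos.1 (by omega)), hf]
    omega
  rintro K' (⟨f, g, hfg, hf, hg, h, -⟩ | ⟨f, hf, h, -⟩ | ⟨f, hf, h, -⟩)
  · rw [Az_of_ne hf, Az_of_ne hg, gdist_f₀, gdist_f₀] at h
    simp only [gdist, abs_eq_max_neg] at hfg
    omega
  · rw [hnb f hf] at h
    exact lt_irrefl _ h
  · rw [hnb f hf] at h
    exact lt_irrefl _ h

theorem second_regime_aztec_termination
    (n r : ℕ) (h2 : 2 ≤ r) (hr : r ≤ (n + 1) / 2) :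
    Reaches n (pulse n r) (Az n) ∧ Stable n (Az n) :=
  ⟨(balanced_pulse n r).reaches_Az (by omega), stable_Az n⟩
end

section
/- Let n, ℓ ∈ ℕ with n ≥ 1 and 1 ≤ ℓ ≤ ⌈n/2⌉, and let R' be a path-stable configuration reachable from R(ℓ) by path-firing moves. Then for every position i, R'_i ≤ n − ⌈n/2⌉ + ℓ − i + 1 (inequality in ℤ). -/
/-- A path-firing move on path configurations of length `k` (positions `1,…,k`):
fire from position `i` into an adjacent position `j`. -/
def PFireFrom (k i : ℕ) (R R' : ℕ → ℤ) : Prop :=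
  ∃ j : ℕ, 1 ≤ i ∧ i ≤ k ∧ 1 ≤ j ∧ j ≤ k ∧ (i = j + 1 ∨ j = i + 1) ∧
    R j + 2 ≤ R i ∧
    R' = Function.update (Function.update R i (R i - 1)) j (R j + 1)

/-- A path-firing move on path configurations of length `k`. -/
def PFire (k : ℕ) (R R' : ℕ → ℤ) : Prop := ∃ i : ℕ, PFireFrom k i R R'

/-- `R'` is reachable from `R` by path-firing moves along a path of length `k`. -/
def PReaches (k : ℕ) (R R' : ℕ → ℤ) : Prop := Relation.ReflTransGen (PFire k) R R'

/-- A path configuration is path-stable if no path-firing move applies. -/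
def PStable (k : ℕ) (R : ℕ → ℤ) : Prop := ∀ R', ¬ PFire k R R'

/-- The length of the path `𝒫(ℓ)`: `ℓ + (n − ⌈n/2⌉)`. -/
def pathLen (n ℓ : ℕ) : ℕ := ℓ + (n - (n + 1) / 2)

/-- The initial path configuration `R(ℓ)`: the first `ℓ` entries equal `n`,
the remaining `n − ⌈n/2⌉` entries equal `0`. -/
def Rinit (n ℓ : ℕ) : ℕ → ℤ :=
  fun i => if 1 ≤ i ∧ i ≤ ℓ then (n : ℤ) else 0

/-- The shape shared by all configurations reachable from the step configuration of height `n`: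
the entries left of a window `[a, b]` equal `n`, those right of it vanish, and inside the window
the total drop between two positions falls short of their distance by at most `1`. -/
structure IsWindowed (n : ℤ) (k a b : ℕ) (R : ℕ → ℤ) : Prop where
  one_le : 1 ≤ a
  le : a ≤ b
  le_length : b ≤ k
  antitone : ∀ i, 1 ≤ i → i + 1 ≤ k → R (i + 1) ≤ R i
  left : ∀ i, 1 ≤ i → i < a → R i = n
  right : ∀ i, b < i → i ≤ k → R i = 0
  slope : ∀ i c, a ≤ i → i < c → c ≤ b → (c : ℤ) - i - 1 ≤ R i - R c

/-- On a weakly decreasing configuration every firing moves one unit to the right. -/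
theorem PFire.exists_right {k : ℕ} {R R' : ℕ → ℤ}
    (hR : ∀ i, 1 ≤ i → i + 1 ≤ k → R (i + 1) ≤ R i) (h : PFire k R R') :
    ∃ v, 1 ≤ v ∧ v + 1 ≤ k ∧ R (v + 1) + 2 ≤ R v ∧
      R' v = R v - 1 ∧ R' (v + 1) = R (v + 1) + 1 ∧
      ∀ p, p ≠ v → p ≠ v + 1 → R' p = R p := by
  obtain ⟨i, j, hi, hik, hj, hjk, rfl | rfl, hRij, rfl⟩ := h
  · have := hR j hj hik
    omega
  · refine ⟨i, hi, hjk, hRij, by simp, by simp, fun p hp hp' => by simp [hp, hp']⟩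

theorem IsWindowed.exists_of_fire {n : ℤ} {k a b : ℕ} {R R' : ℕ → ℤ}
    (h : IsWindowed n k a b R) (hf : PFire k R R') : ∃ a' b', IsWindowed n k a' b' R' := by
  obtain ⟨v, hv, hvk, hfire, hRv, hRv', hR⟩ := hf.exists_right h.antitone
  obtain ⟨ha, hab, hbk, hanti, hl, hr, hs⟩ := h
  have hva : a ≤ v + 1 := by
    by_contra hlt
    have h₁ := hl v hv (by omega)
    have h₂ := hl (v + 1) (by omega) (by omega)
    omega
  have hvb : v ≤ b := by
    by_contra hlt
    have h₁ := hr v (by omega) (by omega)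
    have h₂ := hr (v + 1) (by omega) (by omega)
    omega
  refine ⟨min a v, max b (v + 1), by omega, by omega, by omega, ?_, ?_, ?_, ?_⟩
  · intro i hi hik
    have := hanti i hi hik
    rcases eq_or_ne i v with rfl | hiv
    · omega
    rcases eq_or_ne i (v + 1) with rfl | hiv'
    · rw [hR (v + 1 + 1) (by omega) (by omega)]
      omega
    rcases eq_or_ne (i + 1) v with rfl | hiv''
    · rw [hR i (by omega) (by omega)]
      omega
    · rw [hR i hiv hiv', hR (i + 1) hiv'' (by omega)]
      exact this
  · intro i hi hia
    rw [hR i (by omega) (by omega)]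
    exact hl i hi (by omega)
  · intro i hi hik
    rw [hR i (by omega) (by omega)]
    exact hr i (by omega) hik
  · intro i c hi hic hc
    have hleft : i ≤ v → (v : ℤ) - i ≤ R' i - R' v := by
      intro hiv
      rcases hiv.eq_or_lt with rfl | hlt
      · omega
      · have := hs i v (by omega) hlt hvb
        rw [hR i (by omega) (by omega)]
        omega
    have hright : v + 1 ≤ c → (c : ℤ) - (v + 1 : ℕ) ≤ R' (v + 1) - R' c := by
      intro hvc
      rcases hvc.eq_or_lt with rfl | hlt
      · omega
      · have := hs (v + 1) c hva hlt (by omega)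
        rw [hR c (by omega) (by omega)]
        omega
    rcases lt_or_ge v i with hvi | hiv
    · rcases hvi.nat_succ_le.eq_or_lt with rfl | hlt
      · have := hright (by omega)
        simp only [Nat.succ_eq_add_one] at *
        omega
      · have := hs i c (by omega) hic (by omega)
        rw [hR i (by omega) (by omega), hR c (by omega) (by omega)]
        exact this
    · rcases lt_or_ge v c with hvc | hcv
      · have h₁ := hleft hiv
        have h₂ := hright hvc
        omega
      · rcases hcv.eq_or_lt with rfl | hlt
        · have := hleft hiv
          omega
        · have := hs i c (by omega) hic (by omega)
          rw [hR i (by omega) (by omega), hR c (by omega) (by omega)]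
          exact this

theorem Finset.sum_update_add {ι M : Type*} [DecidableEq ι] [AddCommGroup M] {s : Finset ι}
    {i : ι} (hi : i ∈ s) (f : ι → M) (x : M) :
    ∑ p ∈ s, Function.update f i (f i + x) p = ∑ p ∈ s, f p + x := by
  rw [Finset.sum_update_of_mem hi, Finset.sdiff_singleton_eq_erase, ← Finset.add_sum_erase s f hi]
  abel

theorem PFire.sum_eq {k : ℕ} {R R' : ℕ → ℤ} (h : PFire k R R') :
    ∑ i ∈ Finset.Icc 1 k, R' i = ∑ i ∈ Finset.Icc 1 k, R i := by
  obtain ⟨i, j, hi, hik, hj, hjk, hij, -, rfl⟩ := h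
  have hji : j ≠ i := by omega
  have hj' := Finset.sum_update_add (Finset.mem_Icc.2 ⟨hj, hjk⟩)
    (Function.update R i (R i + -1)) 1
  rw [Function.update_of_ne hji, Finset.sum_update_add (Finset.mem_Icc.2 ⟨hi, hik⟩)] at hj'
  rw [sub_eq_add_neg, hj']
  ring

theorem isWindowed_Rinit {n ℓ k : ℕ} (hℓ : 1 ≤ ℓ) (hk : ℓ ≤ k) :
    IsWindowed n k ℓ ℓ (Rinit n ℓ) where
  one_le := hℓ
  le := le_rfl
  le_length := hk
  antitone i hi _ := by
    unfold Rinit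
    split_ifs <;> omega
  left i hi hiℓ := if_pos ⟨hi, hiℓ.le⟩
  right i hi _ := if_neg (by omega)
  slope i c _ _ _ := by omega

theorem sum_Rinit {n ℓ k : ℕ} (hk : ℓ ≤ k) :
    ∑ i ∈ Finset.Icc 1 k, Rinit n ℓ i = (n : ℤ) * ℓ := by
  have hsub : Finset.Icc 1 ℓ ⊆ Finset.Icc 1 k := Finset.Icc_subset_Icc_right hk
  rw [← Finset.sum_subset (f := Rinit n ℓ) hsub
      fun i _ hi => if_neg fun h => hi (Finset.mem_Icc.2 h),
    Finset.sum_eq_card_nsmul (f := Rinit n ℓ) (b := (n : ℤ))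
      fun i hi => if_pos (Finset.mem_Icc.1 hi)]
  simp [mul_comm]

theorem PReaches.isWindowed_and_sum_eq {n : ℤ} {k a b : ℕ} {R R' : ℕ → ℤ}
    (h : PReaches k R R') (hR : IsWindowed n k a b R) :
    (∃ a' b', IsWindowed n k a' b' R') ∧
      ∑ i ∈ Finset.Icc 1 k, R' i = ∑ i ∈ Finset.Icc 1 k, R i := by
  induction h with
  | refl => exact ⟨⟨a, b, hR⟩, rfl⟩
  | tail _ hf ih =>
    obtain ⟨⟨a', b', hw⟩, hsum⟩ := ih
    exact ⟨hw.exists_of_fire hf, hf.sum_eq.trans hsum⟩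

theorem PStable.le_succ_add_one {k : ℕ} {R : ℕ → ℤ} (h : PStable k R) {i : ℕ} (hi : 1 ≤ i)
    (hik : i + 1 ≤ k) : R i ≤ R (i + 1) + 1 := by
  by_contra hlt
  exact h _ ⟨i, i + 1, hi, by omega, by omega, hik, Or.inr rfl, by omega, rfl⟩

theorem PStable.le_last_add {k : ℕ} {R : ℕ → ℤ} (h : PStable k R) {i : ℕ} (hi : 1 ≤ i)
    (hik : i ≤ k) : R i ≤ R k + (k - i) := by
  induction hik using Nat.decreasingInduction with
  | self => simp
  | of_succ i hik ih =>
    have h₁ := ih (by omega)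
    have h₂ := h.le_succ_add_one hi hik
    push_cast at h₁
    omega

theorem sum_Icc_sub_add_one (k : ℕ) :
    2 * ∑ i ∈ Finset.Icc 1 k, ((k : ℤ) - i + 1) = k * (k + 1) := by
  induction k with
  | zero => simp
  | succ k ih =>
    rw [Finset.sum_Icc_succ_top (by omega)]
    have : ∑ i ∈ Finset.Icc 1 k, (((k + 1 : ℕ) : ℤ) - i + 1)
        = ∑ i ∈ Finset.Icc 1 k, ((k : ℤ) - i + 1) + k := by
      simp only [Nat.cast_succ, add_sub_right_comm _ (1 : ℤ), Finset.sum_add_distrib]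
      simp
    rw [this]
    push_cast
    linarith

/-- A windowed configuration whose height is at least its length and whose last entry is at
least `2` dominates the staircase, strictly at the last position. -/
theorem IsWindowed.lt_two_mul_sum {n : ℤ} {k a b : ℕ} {R : ℕ → ℤ} (h : IsWindowed n k a b R)
    (hn : k ≤ n) (hlast : 2 ≤ R k) :
    (k : ℤ) * (k + 1) < 2 * ∑ i ∈ Finset.Icc 1 k, R i := by
  obtain ⟨ha, hab, hbk, -, hl, hr, hs⟩ := h
  have hb : b = k := by
    by_contra hne
    have := hr k (by omega) le_rfl
    omega
  subst hb
  rw [← sum_Icc_sub_add_one]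
  refine mul_lt_mul_of_pos_left (Finset.sum_lt_sum ?_ ⟨b, ?_, ?_⟩) two_pos
  · intro i hi
    rw [Finset.mem_Icc] at hi
    rcases lt_or_ge i a with hia | hai
    · have := hl i hi.1 hia
      omega
    · rcases hi.2.eq_or_lt with rfl | hlt
      · omega
      · have := hs i b hai hlt le_rfl
        omega
  · exact Finset.mem_Icc.2 ⟨by omega, le_rfl⟩
  · omega

theorem two_mul_mul_le_pathLen_mul (n ℓ : ℕ) :
    2 * ((n : ℤ) * ℓ) ≤ pathLen n ℓ * (pathLen n ℓ + 1) := by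
  unfold pathLen
  obtain ⟨m, rfl | rfl⟩ := Nat.even_or_odd' n
  · rw [show 2 * m - (2 * m + 1) / 2 = m by omega]
    push_cast
    nlinarith [sq_nonneg ((ℓ : ℤ) - m)]
  · rw [show 2 * m + 1 - (2 * m + 1 + 1) / 2 = m by omega]
    push_cast
    rcases le_or_gt ℓ m with h | h
    · zify at h
      nlinarith
    · zify at h
      nlinarith

theorem stable_path_entry_bound
    (n ℓ : ℕ) (hn : 1 ≤ n) (hℓ : 1 ≤ ℓ) (hℓn : ℓ ≤ (n + 1) / 2)
    (R' : ℕ → ℤ) (hreach : PReaches (pathLen n ℓ) (Rinit n ℓ) R')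
    (hstable : PStable (pathLen n ℓ) R') :
    ∀ i : ℕ, 1 ≤ i → i ≤ pathLen n ℓ →
      R' i ≤ (n : ℤ) - ((n + 1) / 2 : ℕ) + (ℓ : ℤ) - (i : ℤ) + 1 := by
  set k := pathLen n ℓ with hk
  have hℓk : ℓ ≤ k := Nat.le_add_right _ _
  have hkn : (k : ℤ) ≤ n := by
    rw [hk, pathLen]
    omega
  obtain ⟨⟨a, b, hw⟩, hsum⟩ := hreach.isWindowed_and_sum_eq (isWindowed_Rinit hℓ hℓk)
  rw [sum_Rinit hℓk] at hsum
  have hlast : R' k ≤ 1 := by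
    by_contra hlt
    have h₁ := hw.lt_two_mul_sum hkn (by omega)
    have h₂ := two_mul_mul_le_pathLen_mul n ℓ
    rw [hsum] at h₁
    exact absurd h₁ (not_lt.2 h₂)
  intro i hi hik
  have := hstable.le_last_add hi hik
  rw [hk, pathLen] at this hlast
  push_cast at this
  omega
end
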